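/- arXiv:1410.2423 — 2 statements merged into one kernel-verified Lean document; each statement's English description precedes it below -/
import Mathlib

section
/- Let d ≥ 1 be an integer. The set {x ∈ ℂ : x ∉ ℝ, x^d ∈ ℝ, (x−1)^d ∈ ℝ} has exactly (d−1)(d−2) elements. (It is closed under complex conjugation and contains no real point, so the rational simple Harnack curve of degree d given by x ↦ (x^d, (x−1)^d) has exactly (d−1)(d−2)/2 solitary nodes.) -/
open ComplexConjugate in
theorem Complex.mem_range_ofReal_iff_conj_eq {z : ℂ} :
    z ∈ Set.range ((↑) : ℝ → ℂ) ↔ conj z = z := by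
  rw [Complex.conj_eq_iff_real]
  simp only [Set.mem_range, eq_comm]

open ComplexConjugate in
/-- If `conj z = u * z` with `z ≠ 0`, then `z ^ d` is real exactly when `u` is a `d`-th root of
unity. -/
theorem Complex.pow_mem_range_ofReal_iff {z u : ℂ} (hz : z ≠ 0) (h : conj z = u * z) (d : ℕ) :
    z ^ d ∈ Set.range ((↑) : ℝ → ℂ) ↔ u ^ d = 1 := by
  rw [Complex.mem_range_ofReal_iff_conj_eq, map_pow, h, mul_pow]
  exact mul_eq_right₀ (pow_ne_zero d hz)

open ComplexConjugate in
theorem Complex.conj_eq_mul_of_norm_eq_one {u v : ℂ} (hu : ‖u‖ = 1) (hv : ‖v‖ = 1) :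
    conj ((1 - v) / (u - v)) = u * ((1 - v) / (u - v)) := by
  rcases eq_or_ne u v with rfl | huv
  · simp
  have hu0 : u ≠ 0 := norm_ne_zero_iff.mp (by simp [hu])
  have hv0 : v ≠ 0 := norm_ne_zero_iff.mp (by simp [hv])
  have h1 : u - v ≠ 0 := sub_ne_zero.mpr huv
  have h3 : u⁻¹ - v⁻¹ ≠ 0 := sub_ne_zero.mpr fun h => huv (inv_injective h)
  rw [map_div₀, map_sub, map_sub, map_one, ← Complex.inv_eq_conj hu, ← Complex.inv_eq_conj hv,
    ← mul_div_assoc, div_eq_div_iff h3 h1]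
  field_simp
  ring

open ComplexConjugate in
/-- The parameters of the solitary nodes are the points `(1 - v) / (u - v)` for distinct
nontrivial `d`-th roots of unity `u`, `v`. -/
theorem harnack_power_map_node_parameters_eq_image {d : ℕ} (hd : 1 ≤ d) :
    {x : ℂ | x ∉ Set.range ((↑) : ℝ → ℂ) ∧
        x ^ d ∈ Set.range ((↑) : ℝ → ℂ) ∧
        (x - 1) ^ d ∈ Set.range ((↑) : ℝ → ℂ)} =
      (fun p : ℂ × ℂ => (1 - p.2) / (p.1 - p.2)) ''
        (((Polynomial.nthRootsFinset d (1 : ℂ)).erase 1).offDiag : Set (ℂ × ℂ)) := by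
  ext x
  simp only [Set.mem_ofPred_eq, Set.mem_image, Finset.mem_coe, Finset.mem_offDiag,
    Finset.mem_erase, Polynomial.mem_nthRootsFinset hd, Prod.exists]
  constructor
  · rintro ⟨hx, h1, h2⟩
    rw [Complex.mem_range_ofReal_iff_conj_eq] at hx
    have hx0 : x ≠ 0 := by rintro rfl; simp at hx
    have hx1 : x - 1 ≠ 0 := by
      intro h
      rw [sub_eq_zero.mp h] at hx
      simp at hx
    have hu : conj x = conj x / x * x := (div_mul_cancel₀ _ hx0).symm
    have hv : conj (x - 1) = conj (x - 1) / (x - 1) * (x - 1) := (div_mul_cancel₀ _ hx1).symm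
    rw [Complex.pow_mem_range_ofReal_iff hx0 hu] at h1
    rw [Complex.pow_mem_range_ofReal_iff hx1 hv] at h2
    generalize conj x / x = u at *
    generalize conj (x - 1) / (x - 1) = v at *
    rw [map_sub, map_one] at hv
    have hv1 : v ≠ 1 := by
      rintro rfl
      exact hx (by linear_combination hv)
    have huv : u ≠ v := by
      rintro rfl
      exact hv1 (by linear_combination hv - hu)
    refine ⟨u, v, ⟨⟨?_, h1⟩, ⟨hv1, h2⟩, huv⟩, ?_⟩
    · rintro rfl
      exact hx (by simpa using hu)
    · rw [div_eq_iff (sub_ne_zero.mpr huv)]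
      linear_combination hu - hv
  · rintro ⟨u, v, ⟨⟨hu1, hu⟩, ⟨hv1, hv⟩, huv⟩, rfl⟩
    have hun := Complex.norm_eq_one_of_pow_eq_one hu (by omega)
    have hvn := Complex.norm_eq_one_of_pow_eq_one hv (by omega)
    have h0 : u - v ≠ 0 := sub_ne_zero.mpr huv
    have hx0 : (1 - v) / (u - v) ≠ 0 := div_ne_zero (sub_ne_zero.mpr hv1.symm) h0
    have hsub : (1 - v) / (u - v) - 1 = -((1 - u) / (v - u)) := by
      rw [div_sub_one h0, ← neg_sub u v, div_neg, neg_neg]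
      ring
    have hc := Complex.conj_eq_mul_of_norm_eq_one hun hvn
    refine ⟨?_, ?_, ?_⟩
    · rw [Complex.mem_range_ofReal_iff_conj_eq, hc]
      exact fun h => hu1 ((mul_eq_right₀ hx0).mp h)
    · rwa [Complex.pow_mem_range_ofReal_iff hx0 hc]
    · rw [hsub]
      rwa [Complex.pow_mem_range_ofReal_iff (neg_ne_zero.mpr (div_ne_zero
        (sub_ne_zero.mpr hu1.symm) (sub_ne_zero.mpr huv.symm)))
        (by rw [map_neg, Complex.conj_eq_mul_of_norm_eq_one hvn hun, mul_neg])]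

theorem injOn_offDiag_nthRootsFinset_erase_one {d : ℕ} (hd : 1 ≤ d) :
    Set.InjOn (fun p : ℂ × ℂ => (1 - p.2) / (p.1 - p.2))
      (((Polynomial.nthRootsFinset d (1 : ℂ)).erase 1).offDiag : Set (ℂ × ℂ)) := by
  rintro ⟨u, v⟩ h ⟨u', v'⟩ h' heq
  simp only [Finset.mem_coe, Finset.mem_offDiag, Finset.mem_erase,
    Polynomial.mem_nthRootsFinset hd] at h h' heq
  obtain ⟨⟨hu1, hu⟩, ⟨hv1, hv⟩, huv⟩ := h
  obtain ⟨⟨hu1', hu'⟩, ⟨hv1', hv'⟩, huv'⟩ := h'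
  have hd0 : d ≠ 0 := by omega
  have hc := Complex.conj_eq_mul_of_norm_eq_one (Complex.norm_eq_one_of_pow_eq_one hu hd0)
    (Complex.norm_eq_one_of_pow_eq_one hv hd0)
  have hc' := Complex.conj_eq_mul_of_norm_eq_one (Complex.norm_eq_one_of_pow_eq_one hu' hd0)
    (Complex.norm_eq_one_of_pow_eq_one hv' hd0)
  have hx0 : (1 - v) / (u - v) ≠ 0 :=
    div_ne_zero (sub_ne_zero.mpr hv1.symm) (sub_ne_zero.mpr huv)
  rw [← heq, hc] at hc'
  obtain rfl : u = u' := mul_right_cancel₀ hx0 hc'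
  rw [div_eq_div_iff (sub_ne_zero.mpr huv) (sub_ne_zero.mpr huv')] at heq
  have hvv : v = v' :=
    mul_left_cancel₀ (sub_ne_zero.mpr hu1) (by linear_combination -heq)
  rw [hvv]

/-- For `d ≥ 1`, the set of non-real `x ∈ ℂ` with `x ^ d` and
`(x − 1) ^ d` both real has exactly `(d − 1)(d − 2)` elements; these are the
parameters of the solitary nodes of the rational simple Harnack curve
`x ↦ (x ^ d, (x − 1) ^ d)`. -/
theorem harnack_power_map_node_parameters_count
    (d : ℕ) (hd : 1 ≤ d) :
    {x : ℂ | x ∉ Set.range ((↑) : ℝ → ℂ) ∧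
        x ^ d ∈ Set.range ((↑) : ℝ → ℂ) ∧
        (x - 1) ^ d ∈ Set.range ((↑) : ℝ → ℂ)}.ncard = (d - 1) * (d - 2) := by
  rw [harnack_power_map_node_parameters_eq_image hd,
    (injOn_offDiag_nthRootsFinset_erase_one hd).ncard_image, Set.ncard_coe_finset,
    Finset.offDiag_card, Finset.card_erase_of_mem (by simp [Polynomial.mem_nthRootsFinset hd]),
    (Complex.isPrimitiveRoot_exp d (by omega)).card_nthRootsFinset, ← Nat.mul_sub_one,
    Nat.sub_sub]
end

section
/- Let k ≥ 0 and d = 2k+1. Among the non-real x ∈ ℂ with x^d ∈ ℝ and (x−1)^d ∈ ℝ (the solitary-node parameters of the degree-d rational simple Harnack curve x ↦ (x^d, (x−1)^d)): exactly k(k+1) satisfy x^d < 0 and (x−1)^d > 0, and exactly k(k−1) satisfy each of the other three sign patterns (x^d > 0 and (x−1)^d > 0; x^d > 0 and (x−1)^d < 0; x^d < 0 and (x−1)^d < 0). (Here 'x^d > 0' means x^d is real and positive.) This gives the distribution of the (d−1)(d−2)/2 solitary nodes among the four quadrants of the coordinate triangle, as in the topological classification of simple Harnack curves of genus 0 and odd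 degree. -/
open Complex in
/-- The apex of the triangle on the base `[0, 1]` which is seen from `0` under the angle `α` and
from `1` under the angle `β`, both measured from the positive real axis. -/
noncomputable def apex (α β : ℝ) : ℂ :=
  ((Real.sin β / Real.sin (β - α) : ℝ) : ℂ) * exp (α * I)

open Complex in
theorem apex_sub_one {α β : ℝ} (h : Real.sin (β - α) ≠ 0) :
    apex α β - 1 = ((Real.sin α / Real.sin (β - α) : ℝ) : ℂ) * exp (β * I) := by
  apply Complex.ext
  · simp only [apex, sub_re, one_re, re_ofReal_mul, exp_ofReal_mul_I_re]
    field_simp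
    rw [Real.sin_sub]
    ring
  · simp only [apex, sub_im, one_im, im_ofReal_mul, exp_ofReal_mul_I_im]
    field_simp
    ring

open Complex in
theorem arg_pos_mul_exp {r α : ℝ} (hr : 0 < r) (h0 : 0 < α) (h1 : α < Real.pi) :
    arg ((r : ℂ) * exp (α * I)) = α := by
  rw [exp_mul_I]
  exact arg_mul_cos_add_sin_mul_I hr ⟨by linarith, h1.le⟩

open Complex in
theorem eq_apex_of_im_pos {x : ℂ} (hx : 0 < x.im) :
    arg x < arg (x - 1) ∧ x = apex (arg x) (arg (x - 1)) := by
  have hx' : 0 < (x - 1).im := by simpa using hx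
  have hx0 : x ≠ 0 := by rintro rfl; simp at hx
  have hx1 : x - 1 ≠ 0 := by intro h; simp [h] at hx'
  have n0 : 0 < ‖x‖ := norm_pos_iff.2 hx0
  have n1 : 0 < ‖x - 1‖ := norm_pos_iff.2 hx1
  have c0 := norm_mul_cos_arg x
  have s0 := norm_mul_sin_arg x
  have c1 := norm_mul_cos_arg (x - 1)
  have s1 := norm_mul_sin_arg (x - 1)
  simp only [sub_re, one_re, sub_im, one_im, sub_zero] at c1 s1
  have key : ‖x‖ * ‖x - 1‖ * Real.sin (arg (x - 1) - arg x) = x.im := by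
    rw [Real.sin_sub]
    linear_combination (‖x‖ * Real.cos (arg x)) * s1 + x.im * c0 -
      (‖x‖ * Real.sin (arg x)) * c1 - (x.re - 1) * s0
  have hs : 0 < Real.sin (arg (x - 1) - arg x) := by
    rw [← key] at hx
    exact (pos_iff_pos_of_mul_pos hx).1 (mul_pos n0 n1)
  refine ⟨?_, ?_⟩
  · by_contra! hle
    have := Real.sin_nonpos_of_nonpos_of_neg_pi_le (x := arg (x - 1) - arg x) (by linarith)
      (by linarith [arg_le_pi x, arg_nonneg_iff.2 hx'.le])
    linarith
  · have hn : Real.sin (arg (x - 1)) / Real.sin (arg (x - 1) - arg x) = ‖x‖ := by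
      rw [div_eq_iff hs.ne']
      apply mul_left_cancel₀ n1.ne'
      linarith
    rw [apex, hn, norm_mul_exp_arg_mul_I]

open Complex in
theorem exists_arg_eq_of_pow {d p : ℕ} (hd : 0 < d) (hp : p ≤ 1) {x : ℂ} (hx : 0 < x.im) {r : ℝ}
    (hr : 0 < r) (h : x ^ d = (-1) ^ p * (r : ℂ)) :
    ∃ a : ℕ, 0 < a ∧ a < d ∧ a % 2 = p ∧ arg x = a * Real.pi / d := by
  have hdR : (0 : ℝ) < d := by exact_mod_cast hd
  have hnorm : ‖x‖ ^ d = r := by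
    have := congrArg norm h
    simpa [abs_of_pos hr] using this
  have hrC : (r : ℂ) ≠ 0 := by exact_mod_cast hr.ne'
  have hexp : exp (((d * arg x : ℝ) : ℂ) * I) = exp (((p * Real.pi : ℝ) : ℂ) * I) := by
    have h1 : exp (((p * Real.pi : ℝ) : ℂ) * I) = (-1) ^ p := by
      rw [← exp_pi_mul_I, ← exp_nat_mul]
      push_cast
      ring_nf
    have h2 : exp (((d * arg x : ℝ) : ℂ) * I) = exp (arg x * I) ^ d := by
      rw [← exp_nat_mul]
      push_cast
      ring_nf
    rw [h1, h2]
    apply mul_left_cancel₀ hrC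
    rw [← norm_mul_exp_arg_mul_I x, mul_pow, ← ofReal_pow, hnorm] at h
    rw [h, mul_comm]
  obtain ⟨n, hn⟩ := exp_eq_exp_iff_exists_int.1 hexp
  have hn' : (d : ℝ) * arg x = (p + 2 * n : ℤ) * Real.pi := by
    have := congrArg im hn
    simp at this
    push_cast
    linarith
  have harg0 : 0 < arg x :=
    lt_of_le_of_ne (arg_nonneg_iff.2 hx.le) fun h => hx.ne' (arg_eq_zero_iff.1 h.symm).2
  have hargpi : arg x < Real.pi := (arg_lt_pi_iff).2 (Or.inr hx.ne')
  have hpos : 0 < (p + 2 * n : ℤ) := by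
    have : 0 < ((p + 2 * n : ℤ) : ℝ) * Real.pi := hn' ▸ mul_pos hdR harg0
    exact_mod_cast pos_of_mul_pos_left this Real.pi_pos.le
  have hlt : (p + 2 * n : ℤ) < d := by
    have : ((p + 2 * n : ℤ) : ℝ) * Real.pi < d * Real.pi := hn' ▸ mul_lt_mul_of_pos_left hargpi hdR
    exact_mod_cast lt_of_mul_lt_mul_right this Real.pi_pos.le
  obtain ⟨a, ha⟩ := Int.eq_ofNat_of_zero_le hpos.le
  refine ⟨a, by omega, by omega, by omega, ?_⟩
  rw [ha] at hn'
  rw [eq_div_iff hdR.ne', mul_comm, hn']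
  simp

open Complex in
theorem pos_mul_exp_pow {d p a : ℕ} (hd : 0 < d) (ha : a % 2 = p) {r : ℝ} (hr : 0 < r) :
    ∃ s : ℝ, 0 < s ∧ ((r : ℂ) * exp ((a * Real.pi / d : ℝ) * I)) ^ d = (-1) ^ p * (s : ℂ) := by
  refine ⟨r ^ d, by positivity, ?_⟩
  have hdC : (d : ℂ) ≠ 0 := by exact_mod_cast hd.ne'
  have h1 : (d : ℂ) * (((a * Real.pi / d : ℝ) : ℂ) * I) = a * (Real.pi * I) := by
    push_cast
    field_simp
  rw [mul_pow, ← exp_nat_mul, h1, exp_nat_mul, exp_pi_mul_I, neg_one_pow_eq_pow_mod_two, ha]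
  push_cast
  ring

/-- The parameters in the open upper half plane whose coordinates `x ^ d` and `(x - 1) ^ d` are
real of signs `(-1) ^ p` and `(-1) ^ q`. -/
def upperNodeParameters (d p q : ℕ) : Set ℂ :=
  {x : ℂ | 0 < x.im ∧ (∃ r : ℝ, 0 < r ∧ x ^ d = (-1) ^ p * (r : ℂ)) ∧
    ∃ s : ℝ, 0 < s ∧ (x - 1) ^ d = (-1) ^ q * (s : ℂ)}

/-- Pairs `(i, j)` for which the angles `(2 * i + 2 - p) * π / d` and `(2 * j + 2 - q) * π / d`
are increasing. -/
def angleIndices (k p q : ℕ) : Finset (ℕ × ℕ) :=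
  (Finset.range k ×ˢ Finset.range k).filter fun ij => 2 * ij.1 + q < 2 * ij.2 + p

/-- The apex attached to a pair of angle indices. -/
noncomputable def nodeParameter (k p q : ℕ) (ij : ℕ × ℕ) : ℂ :=
  apex ((2 * ij.1 + 2 - p : ℕ) * Real.pi / (2 * k + 1 : ℕ))
    ((2 * ij.2 + 2 - q : ℕ) * Real.pi / (2 * k + 1 : ℕ))

theorem angle_mem_Ioo {d a : ℕ} (ha : 0 < a) (had : a < d) :
    0 < (a * Real.pi / d : ℝ) ∧ (a * Real.pi / d : ℝ) < Real.pi := by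
  have hd : (0 : ℝ) < d := by exact_mod_cast ha.trans had
  have ha' : (0 : ℝ) < a := by exact_mod_cast ha
  have had' : (a : ℝ) < d := by exact_mod_cast had
  refine ⟨by positivity, ?_⟩
  rw [div_lt_iff₀ hd]
  nlinarith [Real.pi_pos]

theorem angle_injective {d a b : ℕ} (hd : 0 < d)
    (h : (a * Real.pi / d : ℝ) = b * Real.pi / d) : a = b := by
  have hd' : (d : ℝ) ≠ 0 := by exact_mod_cast hd.ne'
  rw [div_left_inj' hd', mul_left_inj' Real.pi_ne_zero] at h
  exact_mod_cast h

open Complex in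
theorem apex_angles {d a b : ℕ} (ha : 0 < a) (hab : a < b) (hb : b < d) :
    arg (apex (a * Real.pi / d) (b * Real.pi / d)) = a * Real.pi / d ∧
    arg (apex (a * Real.pi / d) (b * Real.pi / d) - 1) = b * Real.pi / d ∧
    apex (a * Real.pi / d) (b * Real.pi / d) ∈ upperNodeParameters d (a % 2) (b % 2) := by
  obtain ⟨hα0, hα1⟩ := angle_mem_Ioo ha (hab.trans hb)
  obtain ⟨hβ0, hβ1⟩ := angle_mem_Ioo (ha.trans hab) hb
  have hd : 0 < d := by omega
  have hαβ : (a * Real.pi / d : ℝ) < b * Real.pi / d := by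
    have : (0 : ℝ) < d := by exact_mod_cast hd
    have : (a : ℝ) < b := by exact_mod_cast hab
    have := Real.pi_pos
    gcongr
  have hsα := Real.sin_pos_of_pos_of_lt_pi hα0 hα1
  have hsβ := Real.sin_pos_of_pos_of_lt_pi hβ0 hβ1
  have hs := Real.sin_pos_of_pos_of_lt_pi (sub_pos.2 hαβ) (by linarith)
  rw [upperNodeParameters, Set.mem_ofPred_eq, apex_sub_one hs.ne', apex]
  refine ⟨arg_pos_mul_exp (by positivity) hα0 hα1, arg_pos_mul_exp (by positivity) hβ0 hβ1, ?_,
    pos_mul_exp_pow hd rfl (by positivity), pos_mul_exp_pow hd rfl (by positivity)⟩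
  rw [im_ofReal_mul, exp_ofReal_mul_I_im]
  positivity

theorem mem_angleIndices_bounds {k p q : ℕ} (hp : p ≤ 1) (hq : q ≤ 1) {ij : ℕ × ℕ}
    (h : ij ∈ angleIndices k p q) :
    0 < 2 * ij.1 + 2 - p ∧ 2 * ij.1 + 2 - p < 2 * ij.2 + 2 - q ∧
      2 * ij.2 + 2 - q < 2 * k + 1 := by
  simp only [angleIndices, Finset.mem_filter, Finset.mem_product, Finset.mem_range] at h
  omega

theorem image_nodeParameter {k p q : ℕ} (hp : p ≤ 1) (hq : q ≤ 1) :
    nodeParameter k p q '' (angleIndices k p q : Set (ℕ × ℕ)) =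
      upperNodeParameters (2 * k + 1) p q := by
  ext x
  constructor
  · rintro ⟨ij, h, rfl⟩
    obtain ⟨h1, h2, h3⟩ := mem_angleIndices_bounds hp hq h
    have := (apex_angles h1 h2 h3).2.2
    rwa [show (2 * ij.1 + 2 - p) % 2 = p by omega,
      show (2 * ij.2 + 2 - q) % 2 = q by omega] at this
  · rintro ⟨hx, ⟨r, hr, hxr⟩, s, hs, hxs⟩
    obtain ⟨a, ha0, had, hap, ha⟩ := exists_arg_eq_of_pow (Nat.succ_pos _) hp hx hr hxr
    obtain ⟨b, hb0, hbd, hbq, hb⟩ :=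
      exists_arg_eq_of_pow (Nat.succ_pos _) hq (x := x - 1) (by simpa using hx) hs hxs
    obtain ⟨hlt, heq⟩ := eq_apex_of_im_pos hx
    have hab : a < b := by
      by_contra! hba
      rw [ha, hb] at hlt
      have : (b : ℝ) ≤ a := by exact_mod_cast hba
      have := Real.pi_pos
      refine absurd hlt (not_lt.2 ?_)
      gcongr
    refine ⟨((a + p) / 2 - 1, (b + q) / 2 - 1), ?_, ?_⟩
    · simp only [angleIndices, Finset.coe_filter, Finset.mem_product, Finset.mem_range,
        Set.mem_ofPred_eq]
      omega
    · rw [heq, nodeParameter, ha, hb]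
      dsimp only
      rw [show 2 * ((a + p) / 2 - 1) + 2 - p = a by omega,
        show 2 * ((b + q) / 2 - 1) + 2 - q = b by omega]

theorem injOn_nodeParameter {k p q : ℕ} (hp : p ≤ 1) (hq : q ≤ 1) :
    Set.InjOn (nodeParameter k p q) (angleIndices k p q : Set (ℕ × ℕ)) := by
  intro u hu v hv huv
  obtain ⟨hu1, hu2, hu3⟩ := mem_angleIndices_bounds hp hq hu
  obtain ⟨hv1, hv2, hv3⟩ := mem_angleIndices_bounds hp hq hv
  obtain ⟨hua, hub, -⟩ := apex_angles hu1 hu2 hu3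
  obtain ⟨hva, hvb, -⟩ := apex_angles hv1 hv2 hv3
  rw [nodeParameter, nodeParameter] at huv
  rw [huv] at hua hub
  have h1 := angle_injective (Nat.succ_pos _) (hua.symm.trans hva)
  have h2 := angle_injective (Nat.succ_pos _) (hub.symm.trans hvb)
  ext <;> omega

theorem exists_conj_pow_eq {d p : ℕ} {x : ℂ} (h : ∃ r : ℝ, 0 < r ∧ x ^ d = (-1) ^ p * (r : ℂ)) :
    ∃ r : ℝ, 0 < r ∧ (starRingEnd ℂ x) ^ d = (-1) ^ p * (r : ℂ) := by
  obtain ⟨r, hr, h⟩ := h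
  refine ⟨r, hr, ?_⟩
  rw [← map_pow, h]
  simp

open ComplexConjugate in
theorem ncard_nodeParameters {k p q : ℕ} (hp : p ≤ 1) (hq : q ≤ 1) :
    {x : ℂ | x.im ≠ 0 ∧ (∃ r : ℝ, 0 < r ∧ x ^ (2 * k + 1) = (-1) ^ p * (r : ℂ)) ∧
      ∃ s : ℝ, 0 < s ∧ (x - 1) ^ (2 * k + 1) = (-1) ^ q * (s : ℂ)}.ncard =
      (angleIndices k p q).card * 2 := by
  have himg := image_nodeParameter (k := k) hp hq
  have hfin : (upperNodeParameters (2 * k + 1) p q).Finite :=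
    himg ▸ (Finset.finite_toSet _).image _
  have hcard : (upperNodeParameters (2 * k + 1) p q).ncard = (angleIndices k p q).card := by
    rw [← himg, (injOn_nodeParameter hp hq).ncard_image, Set.ncard_coe_finset]
  have hunion : {x : ℂ | x.im ≠ 0 ∧
      (∃ r : ℝ, 0 < r ∧ x ^ (2 * k + 1) = (-1) ^ p * (r : ℂ)) ∧
      ∃ s : ℝ, 0 < s ∧ (x - 1) ^ (2 * k + 1) = (-1) ^ q * (s : ℂ)} =
      upperNodeParameters (2 * k + 1) p q ∪ conj '' upperNodeParameters (2 * k + 1) p q := by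
    ext x
    constructor
    · rintro ⟨hx, hr, hs⟩
      rcases hx.lt_or_gt with hx | hx
      · refine Or.inr ⟨conj x, ⟨by simpa using hx, exists_conj_pow_eq hr, ?_⟩, by simp⟩
        simpa using exists_conj_pow_eq hs
      · exact Or.inl ⟨hx, hr, hs⟩
    · rintro (⟨hx, hr, hs⟩ | ⟨y, ⟨hy, hr, hs⟩, rfl⟩)
      · exact ⟨hx.ne', hr, hs⟩
      · refine ⟨by simpa using hy.ne', exists_conj_pow_eq hr, ?_⟩
        simpa using exists_conj_pow_eq hs
  have hdisj : Disjoint (upperNodeParameters (2 * k + 1) p q)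
      (conj '' upperNodeParameters (2 * k + 1) p q) := by
    rw [Set.disjoint_left]
    rintro _ ⟨hx, -⟩ ⟨y, ⟨hy, -⟩, rfl⟩
    rw [Complex.conj_im] at hx
    linarith
  rw [hunion, Set.ncard_union_eq hdisj hfin (hfin.image _),
    Set.ncard_image_of_injective _ (starRingEnd ℂ).injective, hcard]
  ring

theorem card_angleIndices_eq_sum (k p q : ℕ) (f : ℕ → ℕ)
    (h : ∀ i j, j < k → (i < f j ↔ i < k ∧ 2 * i + q < 2 * j + p)) :
    (angleIndices k p q).card = ∑ j ∈ Finset.range k, f j := by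
  rw [angleIndices, Finset.card_filter, Finset.sum_product_right]
  refine Finset.sum_congr rfl fun j hj => ?_
  rw [← Finset.card_filter, ← Finset.card_range (f j)]
  congr 1
  ext i
  simp [h i j (Finset.mem_range.1 hj)]

theorem card_angleIndices_mul_two_of_le {k p q : ℕ} (hp : p ≤ 1) (hq : q ≤ 1) (hpq : p ≤ q) :
    (angleIndices k p q).card * 2 = k * (k - 1) := by
  rw [card_angleIndices_eq_sum k p q (fun j => j) (by omega), Finset.sum_range_id_mul_two]

theorem card_angleIndices_one_zero_mul_two (k : ℕ) :
    (angleIndices k 1 0).card * 2 = k * (k + 1) := by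
  rw [card_angleIndices_eq_sum k 1 0 (fun j => j + 1) (by omega), Finset.sum_add_distrib, add_mul,
    Finset.sum_range_id_mul_two]
  cases k <;> simp
  ring

theorem exists_pow_eq_pos_iff (z : ℂ) :
    (∃ r : ℝ, z = (r : ℂ) ∧ 0 < r) ↔ ∃ r : ℝ, 0 < r ∧ z = (-1) ^ 0 * (r : ℂ) := by
  simp [and_comm]

theorem exists_pow_eq_neg_iff (z : ℂ) :
    (∃ r : ℝ, z = (r : ℂ) ∧ r < 0) ↔ ∃ r : ℝ, 0 < r ∧ z = (-1) ^ 1 * (r : ℂ) := by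
  constructor
  · rintro ⟨r, rfl, hr⟩
    exact ⟨-r, by linarith, by simp⟩
  · rintro ⟨r, hr, rfl⟩
    exact ⟨-r, by simp, by linarith⟩

theorem notMem_range_ofReal_iff (x : ℂ) : x ∉ Set.range ((↑) : ℝ → ℂ) ↔ x.im ≠ 0 := by
  refine not_congr ⟨?_, fun h => ⟨x.re, ?_⟩⟩
  · rintro ⟨r, rfl⟩
    simp
  · apply Complex.ext <;> simp [h]


/-- Let `d = 2k + 1` with `k ≥ 0`. Among the non-real `x ∈ ℂ` with
`x ^ d` and `(x − 1) ^ d` real (the solitary-node parameters of the degree-`d`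
rational simple Harnack curve `x ↦ (x ^ d, (x − 1) ^ d)`), exactly `k(k+1)` have
`x ^ d < 0` and `(x−1) ^ d > 0`, and exactly `k(k−1)` lie in each of the three other
sign quadrants. -/
theorem harnack_power_map_node_distribution_odd
    (k : ℕ) (d : ℕ) (hd : d = 2 * k + 1) :
    ({x : ℂ | (x ∉ Set.range ((↑) : ℝ → ℂ)) ∧
        (∃ r : ℝ, x ^ d = (r : ℂ) ∧ r < 0) ∧
        (∃ s : ℝ, (x - 1) ^ d = (s : ℂ) ∧ 0 < s)}.ncard = k * (k + 1)) ∧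
    ({x : ℂ | (x ∉ Set.range ((↑) : ℝ → ℂ)) ∧
        (∃ r : ℝ, x ^ d = (r : ℂ) ∧ 0 < r) ∧
        (∃ s : ℝ, (x - 1) ^ d = (s : ℂ) ∧ 0 < s)}.ncard = k * (k - 1)) ∧
    ({x : ℂ | (x ∉ Set.range ((↑) : ℝ → ℂ)) ∧
        (∃ r : ℝ, x ^ d = (r : ℂ) ∧ 0 < r) ∧
        (∃ s : ℝ, (x - 1) ^ d = (s : ℂ) ∧ s < 0)}.ncard = k * (k - 1)) ∧
    ({x : ℂ | (x ∉ Set.range ((↑) : ℝ → ℂ)) ∧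
        (∃ r : ℝ, x ^ d = (r : ℂ) ∧ r < 0) ∧
        (∃ s : ℝ, (x - 1) ^ d = (s : ℂ) ∧ s < 0)}.ncard = k * (k - 1)) := by
  subst hd
  simp only [notMem_range_ofReal_iff, exists_pow_eq_pos_iff, exists_pow_eq_neg_iff]
  refine ⟨?_, ?_, ?_, ?_⟩
  · rw [ncard_nodeParameters le_rfl zero_le_one, card_angleIndices_one_zero_mul_two]
  · rw [ncard_nodeParameters zero_le_one zero_le_one,
      card_angleIndices_mul_two_of_le zero_le_one zero_le_one le_rfl]
  · rw [ncard_nodeParameters zero_le_one le_rfl,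
      card_angleIndices_mul_two_of_le zero_le_one le_rfl zero_le_one]
  · rw [ncard_nodeParameters le_rfl le_rfl, card_angleIndices_mul_two_of_le le_rfl le_rfl le_rfl]
end
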